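/- If V is a weight module over the Schrödinger–Virasoro Lie algebra 𝔰𝔳 that is unitary for some conjugate-linear anti-involution θ of 𝔰𝔳, then M_n·v = 0 and Y_{n+1/2}·v = 0 for all n ∈ ℤ and all v ∈ V; that is, every unitary weight module over 𝔰𝔳 is simply a unitary weight module over the Virasoro subalgebra, with M and Y acting trivially. -/

import Mathlib

/-- Index type for the distinguished basis of the Schrödinger–Virasoro algebra.
`Y n` stands for the basis element `Y_{n+1/2}`. -/
inductive SVIndex : Type
  | L : ℤ → SVIndex
  | M : ℤ → SVIndex
  | Y : ℤ → SVIndex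
  | c : SVIndex

/-- A realization of the Schrödinger–Virasoro Lie algebra: a complex Lie algebra `sv`
with distinguished elements `L n`, `M n`, `Y n` (representing `Y_{n+1/2}`) and `c`
which form a basis and satisfy the defining bracket relations. -/
structure SVAlgebra (sv : Type*) [LieRing sv] [LieAlgebra ℂ sv] where
  L : ℤ → sv
  M : ℤ → sv
  Y : ℤ → sv
  c : sv
  indep : LinearIndependent ℂ (fun i : SVIndex =>
    match i with
    | .L n => L n
    | .M n => M n
    | .Y n => Y n
    | .c => c)
  span_top : Submodule.span ℂ (Set.range (fun i : SVIndex =>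
    match i with
    | .L n => L n
    | .M n => M n
    | .Y n => Y n
    | .c => c)) = ⊤
  bracket_LL : ∀ m n : ℤ, ⁅L m, L n⁆ =
    ((n : ℂ) - (m : ℂ)) • L (m + n)
      + (if m + n = 0 then ((m : ℂ) ^ 3 - (m : ℂ)) / 12 else 0) • c
  bracket_LM : ∀ m n : ℤ, ⁅L m, M n⁆ = (n : ℂ) • M (m + n)
  bracket_LY : ∀ m n : ℤ, ⁅L m, Y n⁆ = ((n : ℂ) + (1 - (m : ℂ)) / 2) • Y (m + n)
  bracket_YY : ∀ m n : ℤ, ⁅Y m, Y n⁆ = ((n : ℂ) - (m : ℂ)) • M (m + n + 1)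
  bracket_MM : ∀ m n : ℤ, ⁅M m, M n⁆ = 0
  bracket_MY : ∀ m n : ℤ, ⁅M m, Y n⁆ = 0
  bracket_c : ∀ x : sv, ⁅x, c⁆ = 0

/-- A conjugate-linear anti-involution of a complex Lie algebra. -/
structure ConjAntiInvolution (sv : Type*) [LieRing sv] [LieAlgebra ℂ sv] where
  toFun : sv → sv
  map_add' : ∀ x y : sv, toFun (x + y) = toFun x + toFun y
  map_smul' : ∀ (a : ℂ) (x : sv), toFun (a • x) = (starRingEnd ℂ a) • toFun x
  map_bracket' : ∀ x y : sv, toFun ⁅x, y⁆ = ⁅toFun y, toFun x⁆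
  invol' : ∀ x : sv, toFun (toFun x) = x

variable {sv : Type*} [LieRing sv] [LieAlgebra ℂ sv]

/-- The simultaneous eigenspace of `L 0`, `M 0`, `c` with eigenvalue triple `χ`. -/
def svWeightSpace (A : SVAlgebra sv) (V : Type*) [AddCommGroup V] [Module ℂ V]
    [LieRingModule sv V] [LieModule ℂ sv V] (χ : ℂ × ℂ × ℂ) : Submodule ℂ V :=
  Module.End.eigenspace (LieModule.toEnd ℂ sv V (A.L 0)) χ.1 ⊓
    Module.End.eigenspace (LieModule.toEnd ℂ sv V (A.M 0)) χ.2.1 ⊓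
    Module.End.eigenspace (LieModule.toEnd ℂ sv V A.c) χ.2.2

/-- `V` is a weight module: it is the (direct) sum of the simultaneous eigenspaces
of `L 0`, `M 0`, `c`, each of which is finite-dimensional. -/
def IsWeightModule (A : SVAlgebra sv) (V : Type*) [AddCommGroup V] [Module ℂ V]
    [LieRingModule sv V] [LieModule ℂ sv V] : Prop :=
  (∀ χ : ℂ × ℂ × ℂ, FiniteDimensional ℂ (svWeightSpace A V χ)) ∧
    (⨆ χ : ℂ × ℂ × ℂ, svWeightSpace A V χ) = ⊤

/-- `B` is a positive-definite Hermitian sesquilinear form on `V` that is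
contravariant with respect to the map `θ`. -/
def IsUnitaryForm (θ : sv → sv) (V : Type*) [AddCommGroup V] [Module ℂ V]
    [LieRingModule sv V] (B : V → V → ℂ) : Prop :=
  (∀ u v w : V, B (u + v) w = B u w + B v w) ∧
  (∀ (a : ℂ) (u v : V), B (a • u) v = a * B u v) ∧
  (∀ u v : V, B u v = starRingEnd ℂ (B v u)) ∧
  (∀ v : V, v ≠ 0 → 0 < (B v v).re) ∧
  (∀ (x : sv) (u v : V), B ⁅x, u⁆ v = B u ⁅θ x, v⁆)

/-- `V` is unitary for the conjugate-linear anti-involution `θ`. -/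
def IsUnitaryFor (θ : sv → sv) (V : Type*) [AddCommGroup V] [Module ℂ V]
    [LieRingModule sv V] : Prop :=
  ∃ B : V → V → ℂ, IsUnitaryForm θ V B

variable {V : Type*} [AddCommGroup V] [Module ℂ V] [LieRingModule sv V] [LieModule ℂ sv V]

namespace SVProof

open LaurentPolynomial

/-- The distinguished family. -/
def fam (A : SVAlgebra sv) : SVIndex → sv := fun i =>
    match i with
    | .L n => A.L n
    | .M n => A.M n
    | .Y n => A.Y n
    | .c => A.c

/-- The distinguished basis. -/
noncomputable def bas (A : SVAlgebra sv) : Module.Basis SVIndex ℂ sv :=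
  Module.Basis.mk (v := fam A) A.indep (le_of_eq A.span_top.symm)

theorem bas_L (A : SVAlgebra sv) (n : ℤ) : bas A (.L n) = A.L n :=
  Module.Basis.mk_apply _ _ _
theorem bas_M (A : SVAlgebra sv) (n : ℤ) : bas A (.M n) = A.M n :=
  Module.Basis.mk_apply _ _ _
theorem bas_Y (A : SVAlgebra sv) (n : ℤ) : bas A (.Y n) = A.Y n :=
  Module.Basis.mk_apply _ _ _
theorem bas_c (A : SVAlgebra sv) : bas A .c = A.c :=
  Module.Basis.mk_apply _ _ _

/-- Two-variable induction on the distinguished basis for linear maps. -/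
theorem lin_ext {W : Type*} [AddCommGroup W] [Module ℂ W] (A : SVAlgebra sv) (f g : sv →ₗ[ℂ] W)
    (hL : ∀ n, f (A.L n) = g (A.L n)) (hM : ∀ n, f (A.M n) = g (A.M n))
    (hY : ∀ n, f (A.Y n) = g (A.Y n)) (hc : f A.c = g A.c) (x : sv) : f x = g x := by
  have : f = g := by
    apply (bas A).ext
    rintro (n | n | n | _)
    · simpa [bas_L] using hL n
    · simpa [bas_M] using hM n
    · simpa [bas_Y] using hY n
    · simpa [bas_c] using hc
  rw [this]

/-- The map `L_n ↦ n^k T^n`, killing `M`, `Y`, `c`. -/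
noncomputable def dl (A : SVAlgebra sv) (k : ℕ) : sv →ₗ[ℂ] ℂ[T;T⁻¹] :=
  (bas A).constr ℂ (fun i => match i with
    | .L n => ((n : ℂ) ^ k) • (T n : ℂ[T;T⁻¹])
    | _ => 0)

theorem dl_L (A : SVAlgebra sv) (k : ℕ) (n : ℤ) :
    dl A k (A.L n) = ((n : ℂ) ^ k) • (T n : ℂ[T;T⁻¹]) := by
  rw [← bas_L, dl, Module.Basis.constr_basis]
theorem dl_M (A : SVAlgebra sv) (k : ℕ) (n : ℤ) : dl A k (A.M n) = 0 := by
  rw [← bas_M, dl, Module.Basis.constr_basis]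
theorem dl_Y (A : SVAlgebra sv) (k : ℕ) (n : ℤ) : dl A k (A.Y n) = 0 := by
  rw [← bas_Y, dl, Module.Basis.constr_basis]
theorem dl_c (A : SVAlgebra sv) (k : ℕ) : dl A k A.c = 0 := by
  rw [← bas_c, dl, Module.Basis.constr_basis]

theorem br_ML (A : SVAlgebra sv) (m n : ℤ) : ⁅A.M n, A.L m⁆ = -((n : ℂ) • A.M (m + n)) := by
  rw [← lie_skew, A.bracket_LM]
theorem br_YL (A : SVAlgebra sv) (m n : ℤ) :
    ⁅A.Y n, A.L m⁆ = -(((n : ℂ) + (1 - (m : ℂ)) / 2) • A.Y (m + n)) := by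
  rw [← lie_skew, A.bracket_LY]
theorem br_YM (A : SVAlgebra sv) (m n : ℤ) : ⁅A.Y n, A.M m⁆ = 0 := by
  rw [← lie_skew, A.bracket_MY, neg_zero]
theorem br_c (A : SVAlgebra sv) (x : sv) : ⁅A.c, x⁆ = 0 := by
  rw [← lie_skew, A.bracket_c, neg_zero]

/-- bilinear extension -/
theorem bil_ext {W : Type*} [AddCommGroup W] [Module ℂ W] (A : SVAlgebra sv)
    (F : sv →ₗ[ℂ] W) (G : sv →ₗ[ℂ] sv →ₗ[ℂ] W)
    (hLL : ∀ m n, F ⁅A.L m, A.L n⁆ = G (A.L m) (A.L n))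
    (hF : ∀ n, F (A.M n) = 0) (hF' : ∀ n, F (A.Y n) = 0)
    (h1 : ∀ n x, G (A.M n) x = 0) (h2 : ∀ n x, G (A.Y n) x = 0) (h3 : ∀ x, G A.c x = 0)
    (h4 : ∀ n x, G x (A.M n) = 0) (h5 : ∀ n x, G x (A.Y n) = 0) (h6 : ∀ x, G x A.c = 0)
    (x y : sv) : F ⁅x, y⁆ = G x y := by
  have key : ∀ x y, (F ∘ₗ (LieAlgebra.ad ℂ sv x : sv →ₗ[ℂ] sv)) y = G x y := by
    intro x y
    apply lin_ext A
    all_goals (try intro n)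
    · have := lin_ext A (F ∘ₗ (LieAlgebra.ad ℂ sv (A.L n) : sv →ₗ[ℂ] sv)) (-G.flip (A.L n))
        (by intro m
            have h := hLL m n
            have h' := hLL n m
            simp only [LinearMap.comp_apply, LieAlgebra.ad_apply, LinearMap.neg_apply,
              LinearMap.flip_apply]
            rw [← h, ← lie_skew, map_neg])
        (by intro m; simp [A.bracket_LM, hF, h1])
        (by intro m; simp [A.bracket_LY, hF', h2])
        (by simp [A.bracket_c, h3]) x
      simp only [LinearMap.comp_apply, LieAlgebra.ad_apply, LinearMap.neg_apply,
              LinearMap.flip_apply] at this ⊢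
      rw [← lie_skew, map_neg, this, neg_neg]
    · have := lin_ext A (F ∘ₗ (LieAlgebra.ad ℂ sv (A.M n) : sv →ₗ[ℂ] sv)) 0
        (by intro m; simp [br_ML, hF])
        (by intro m; simp [A.bracket_MM])
        (by intro m; simp [A.bracket_MY])
        (by simp [A.bracket_c]) x
      simp only [LinearMap.comp_apply, LieAlgebra.ad_apply, LinearMap.zero_apply] at this ⊢
      rw [← lie_skew, map_neg, this, neg_zero, h4]
    · have := lin_ext A (F ∘ₗ (LieAlgebra.ad ℂ sv (A.Y n) : sv →ₗ[ℂ] sv)) 0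
        (by intro m; simp [br_YL, hF'])
        (by intro m; simp [br_YM])
        (by intro m; simp [A.bracket_YY, hF])
        (by simp [A.bracket_c]) x
      simp only [LinearMap.comp_apply, LieAlgebra.ad_apply, LinearMap.zero_apply] at this ⊢
      rw [← lie_skew, map_neg, this, neg_zero, h5]
    · simp [A.bracket_c, h6]
  exact key x y

/-- The bilinear map `(x, y) ↦ dl i x * dl j y`. -/
noncomputable def G2 (A : SVAlgebra sv) (i j : ℕ) : sv →ₗ[ℂ] sv →ₗ[ℂ] ℂ[T;T⁻¹] :=
  (LinearMap.mul ℂ ℂ[T;T⁻¹]).compl₁₂ (dl A i) (dl A j)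

theorem G2_apply (A : SVAlgebra sv) (i j : ℕ) (x y : sv) : G2 A i j x y = dl A i x * dl A j y := by
  simp [G2]

theorem dl0_br (A : SVAlgebra sv) (x y : sv) :
    dl A 0 ⁅x, y⁆ = dl A 0 x * dl A 1 y - dl A 1 x * dl A 0 y := by
  have := bil_ext A (dl A 0) (G2 A 0 1 - G2 A 1 0)
    (by intro m n
        simp only [A.bracket_LL, map_add, map_smul, dl_c, LinearMap.sub_apply, G2_apply, dl_L,
          smul_mul_smul_comm, ← T_add, smul_smul, smul_zero, add_zero, ← sub_smul]
        congr 1; ring)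
    (dl_M A 0) (dl_Y A 0)
    (by simp [G2_apply, dl_M]) (by simp [G2_apply, dl_Y]) (by simp [G2_apply, dl_c])
    (by simp [G2_apply, dl_M]) (by simp [G2_apply, dl_Y]) (by simp [G2_apply, dl_c]) x y
  simpa [G2_apply] using this

theorem dl1_br (A : SVAlgebra sv) (x y : sv) :
    dl A 1 ⁅x, y⁆ = dl A 0 x * dl A 2 y - dl A 2 x * dl A 0 y := by
  have := bil_ext A (dl A 1) (G2 A 0 2 - G2 A 2 0)
    (by intro m n
        simp only [A.bracket_LL, map_add, map_smul, dl_c, LinearMap.sub_apply, G2_apply, dl_L,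
          smul_mul_smul_comm, ← T_add, smul_smul, smul_zero, add_zero, ← sub_smul]
        congr 1; push_cast; ring)
    (dl_M A 1) (dl_Y A 1)
    (by simp [G2_apply, dl_M]) (by simp [G2_apply, dl_Y]) (by simp [G2_apply, dl_c])
    (by simp [G2_apply, dl_M]) (by simp [G2_apply, dl_Y]) (by simp [G2_apply, dl_c]) x y
  simpa [G2_apply] using this

theorem dl2_br (A : SVAlgebra sv) (x y : sv) :
    dl A 2 ⁅x, y⁆ = dl A 0 x * dl A 3 y + dl A 1 x * dl A 2 y
      - dl A 2 x * dl A 1 y - dl A 3 x * dl A 0 y := by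
  have := bil_ext A (dl A 2) (G2 A 0 3 + G2 A 1 2 - G2 A 2 1 - G2 A 3 0)
    (by intro m n
        simp only [A.bracket_LL, map_add, map_smul, dl_c, LinearMap.sub_apply,
          LinearMap.add_apply, G2_apply, dl_L,
          smul_mul_smul_comm, ← T_add, smul_smul, smul_zero, add_zero, ← sub_smul, ← add_smul]
        congr 1; push_cast; ring)
    (dl_M A 2) (dl_Y A 2)
    (by simp [G2_apply, dl_M]) (by simp [G2_apply, dl_Y]) (by simp [G2_apply, dl_c])
    (by simp [G2_apply, dl_M]) (by simp [G2_apply, dl_Y]) (by simp [G2_apply, dl_c]) x y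
  simpa [G2_apply] using this

theorem dl_zero_of_ad_cube (A : SVAlgebra sv) (x : sv)
    (hx : ∀ y : sv, ⁅x, ⁅x, ⁅x, y⁆⁆⁆ = 0) : dl A 0 x = 0 := by
  have key : ∀ j : ℤ,
      dl A 0 x * (dl A 0 x * (dl A 0 x * (j:ℂ[T;T⁻¹])^3 + dl A 1 x * (j:ℂ[T;T⁻¹])^2
        - dl A 2 x * (j:ℂ[T;T⁻¹]) - dl A 3 x) - dl A 2 x * (dl A 0 x * (j:ℂ[T;T⁻¹]) - dl A 1 x))
      - dl A 1 x * (dl A 0 x * (dl A 0 x * (j:ℂ[T;T⁻¹])^2 - dl A 2 x)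
         - dl A 1 x * (dl A 0 x * (j:ℂ[T;T⁻¹]) - dl A 1 x)) = 0 := by
    intro j
    have h := congrArg (dl A 0) (hx (A.L j))
    have hs : ∀ k, dl A k (A.L j) = ((j : ℂ[T;T⁻¹]) ^ k) * T j := by
      intro k
      rw [dl_L, Algebra.smul_def]
      simp
    rw [map_zero] at h
    simp only [dl0_br, dl1_br, dl2_br, hs] at h
    have h2 : (T j : ℂ[T;T⁻¹]) * T (-j) = 1 := by rw [← T_add]; simp
    refine (isUnit_T j).mul_left_eq_zero.mp ?_
    rw [← h]; ring
  have h0 := key 0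
  have h1 := key 1
  have h2 := key 2
  have h3 := key 3
  push_cast at h0 h1 h2 h3
  have h6 : (6 : ℂ[T;T⁻¹]) * dl A 0 x ^ 3 = 0 := by
    linear_combination h3 - 3 * h2 + 3 * h1 - h0
  have h6' : (6:ℂ) • (dl A 0 x ^ 3) = 0 := by
    rw [Algebra.smul_def, map_ofNat]; exact h6
  have h7 := (smul_eq_zero.mp h6').resolve_left (by norm_num)
  exact pow_eq_zero_iff (by norm_num) |>.mp h7

theorem ad_cube_M (A : SVAlgebra sv) (n : ℤ) (y : sv) : ⁅A.M n, ⁅A.M n, ⁅A.M n, y⁆⁆⁆ = 0 := by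
  have := lin_ext A ((LieAlgebra.ad ℂ sv (A.M n)) ^ 3 : Module.End ℂ sv) 0
    (by intro m; simp [pow_succ, br_ML, A.bracket_MM])
    (by intro m; simp [pow_succ, A.bracket_MM])
    (by intro m; simp [pow_succ, A.bracket_MY])
    (by simp [pow_succ, A.bracket_c]) y
  simpa [pow_succ] using this

theorem ad_cube_Y (A : SVAlgebra sv) (n : ℤ) (y : sv) : ⁅A.Y n, ⁅A.Y n, ⁅A.Y n, y⁆⁆⁆ = 0 := by
  have := lin_ext A ((LieAlgebra.ad ℂ sv (A.Y n)) ^ 3 : Module.End ℂ sv) 0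
    (by intro m; simp [pow_succ, br_YL, br_YM, A.bracket_YY])
    (by intro m; simp [pow_succ, br_YM])
    (by intro m; simp [pow_succ, br_YM, A.bracket_YY])
    (by simp [pow_succ, A.bracket_c]) y
  simpa [pow_succ] using this

theorem ad_cube_theta (θ : ConjAntiInvolution sv) (x : sv)
    (hx : ∀ y : sv, ⁅x, ⁅x, ⁅x, y⁆⁆⁆ = 0) (y : sv) :
    ⁅θ.toFun x, ⁅θ.toFun x, ⁅θ.toFun x, y⁆⁆⁆ = 0 := by
  have h0 : θ.toFun 0 = 0 := by simpa using θ.map_smul' 0 0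
  have h := congrArg θ.toFun (hx (θ.toFun y))
  simp only [θ.map_bracket', θ.invol', h0] at h
  generalize θ.toFun x = X at h ⊢
  have e1 : ⁅X, y⁆ = -⁅y, X⁆ := (lie_skew _ _).symm
  have e2 : ⁅X, ⁅y, X⁆⁆ = -⁅⁅y, X⁆, X⁆ := (lie_skew _ _).symm
  have e3 : ⁅X, ⁅⁅y, X⁆, X⁆⁆ = -⁅⁅⁅y, X⁆, X⁆, X⁆ := (lie_skew _ _).symm
  rw [e1, lie_neg, e2, neg_neg, e3, h, neg_zero]

/-- The linear map `T^n ↦ w n`. -/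
noncomputable def psi {W : Type*} [AddCommGroup W] [Module ℂ W] (w : ℤ → W) : ℂ[T;T⁻¹] →ₗ[ℂ] W :=
  (AddMonoidAlgebra.basis ℤ ℂ).constr ℂ w

theorem psi_T {W : Type*} [AddCommGroup W] [Module ℂ W] (w : ℤ → W) (n : ℤ) :
    psi w (T n) = w n := by
  have h : (T n : ℂ[T;T⁻¹]) = AddMonoidAlgebra.basis ℤ ℂ n :=
    (AddMonoidAlgebra.basis_apply ℂ n).symm
  rw [h, psi, Module.Basis.constr_basis]

/-- `[x, M_k]` depends only on the `L`-part of `x`. -/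
theorem lie_M_of_dl (A : SVAlgebra sv) (x : sv) (hx : dl A 0 x = 0) (k : ℤ) : ⁅x, A.M k⁆ = 0 := by
  have := lin_ext A (LieAlgebra.ad ℂ sv (A.M k) : sv →ₗ[ℂ] sv)
    (psi (fun n => ⁅A.M k, A.L n⁆) ∘ₗ dl A 0)
    (by intro m; simp [dl_L, psi_T])
    (by intro m; simp [dl_M, A.bracket_MM])
    (by intro m; simp [dl_Y, A.bracket_MY])
    (by simp [dl_c, A.bracket_c]) x
  rw [← lie_skew, neg_eq_zero]
  simpa [hx] using this

theorem lie_Y_of_dl (A : SVAlgebra sv) (x : sv) (hx : dl A 0 x = 0) (k : ℤ) :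
    ⁅x, A.Y k⁆ ∈ Submodule.span ℂ (Set.range A.M) := by
  have := lin_ext A
    ((Submodule.span ℂ (Set.range A.M)).mkQ ∘ₗ (LieAlgebra.ad ℂ sv (A.Y k) : sv →ₗ[ℂ] sv))
    ((Submodule.span ℂ (Set.range A.M)).mkQ ∘ₗ psi (fun n => ⁅A.Y k, A.L n⁆) ∘ₗ dl A 0)
    (by intro m; simp [dl_L, psi_T])
    (by intro m; simp [dl_M, br_YM])
    (by intro m
        simp only [LinearMap.comp_apply, LieAlgebra.ad_apply, dl_Y, map_zero, A.bracket_YY,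
          Submodule.mkQ_apply, Submodule.Quotient.mk_eq_zero]
        exact Submodule.smul_mem _ _ (Submodule.subset_span ⟨_, rfl⟩))
    (by simp [dl_c, A.bracket_c]) x
  rw [← lie_skew]
  apply Submodule.neg_mem
  simpa [hx] using this

/-- `θ(M_n)` commutes with all `M_k`. -/
theorem theta_M_M (A : SVAlgebra sv) (θ : ConjAntiInvolution sv) (n k : ℤ) :
    ⁅θ.toFun (A.M n), A.M k⁆ = 0 :=
  lie_M_of_dl A _ (dl_zero_of_ad_cube A _ (ad_cube_theta θ _ (ad_cube_M A n))) k

theorem theta_Y_Y (A : SVAlgebra sv) (θ : ConjAntiInvolution sv) (n k : ℤ) :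
    ⁅θ.toFun (A.Y n), A.Y k⁆ ∈ Submodule.span ℂ (Set.range A.M) :=
  lie_Y_of_dl A _ (dl_zero_of_ad_cube A _ (ad_cube_theta θ _ (ad_cube_Y A n))) k

end SVProof
namespace SVProof

/-- positive definite Hermitian form -/
structure Form (B : V → V → ℂ) : Prop where
  add : ∀ u v w : V, B (u + v) w = B u w + B v w
  smul : ∀ (a : ℂ) (u v : V), B (a • u) v = a * B u v
  herm : ∀ u v : V, B u v = starRingEnd ℂ (B v u)
  pos : ∀ v : V, v ≠ 0 → 0 < (B v v).re

/-- The second operator is adjoint to the first. -/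
def Adj (B : V → V → ℂ) (N N' : Module.End ℂ V) : Prop := ∀ u v, B (N u) v = B u (N' v)

section form
variable {B : V → V → ℂ}

theorem Form.add_right (hB : Form B) (u v w : V) : B u (v + w) = B u v + B u w := by
  rw [hB.herm, hB.add, map_add, ← hB.herm, ← hB.herm]
theorem Form.smul_right (hB : Form B) (a : ℂ) (u v : V) :
    B u (a • v) = starRingEnd ℂ a * B u v := by
  rw [hB.herm, hB.smul, map_mul, ← hB.herm]
theorem Form.zero_left (hB : Form B) (v : V) : B 0 v = 0 := by
  simpa using hB.smul 0 0 v
theorem Form.zero_right (hB : Form B) (v : V) : B v 0 = 0 := by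
  simpa using hB.smul_right 0 v 0
theorem Form.eq_zero (hB : Form B) (v : V) (h : B v v = 0) : v = 0 := by
  by_contra hv
  have := hB.pos v hv
  rw [h] at this
  simp at this

theorem Adj.symm (hB : Form B) {N N' : Module.End ℂ V} (h : Adj B N N') : Adj B N' N := by
  intro u v
  rw [hB.herm, ← h, ← hB.herm]
theorem Adj.mul {N N' P P' : Module.End ℂ V} (h : Adj B N N') (h' : Adj B P P') :
    Adj B (N * P) (P' * N') := by
  intro u v
  simp only [Module.End.mul_apply]
  rw [h, h']
theorem Adj.sub (hB : Form B) {N N' P P' : Module.End ℂ V} (h : Adj B N N') (h' : Adj B P P') :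
    Adj B (N - P) (N' - P') := by
  intro u v
  have e1 : (N - P) u = N u + (-1 : ℂ) • P u := by simp [sub_eq_add_neg]
  have e2 : (N' - P') v = N' v + (-1 : ℂ) • P' v := by simp [sub_eq_add_neg]
  rw [e1, e2, hB.add, hB.smul, hB.add_right, hB.smul_right, h, h']
  simp
theorem Adj.scalar (hB : Form B) (a : ℂ) :
    Adj B (algebraMap ℂ (Module.End ℂ V) a) (algebraMap ℂ (Module.End ℂ V) (starRingEnd ℂ a)) := by
  intro u v
  simp only [Module.algebraMap_end_apply]
  rw [hB.smul, hB.smul_right]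
  simp

theorem normal_sq (hB : Form B) {N N' : Module.End ℂ V} (h : Adj B N N') (hc : Commute N N')
    (v : V) (hv : N (N v) = 0) : N v = 0 := by
  have hc' : ∀ u, N (N' u) = N' (N u) := fun u => congrArg (fun f : Module.End ℂ V => f u) hc.eq
  have h1 : N' (N v) = 0 := by
    apply hB.eq_zero
    rw [h.symm hB, hc', hv, map_zero, hB.zero_right]
  apply hB.eq_zero
  rw [h, h1, hB.zero_right]

theorem normal_pow (hB : Form B) {N N' : Module.End ℂ V} (h : Adj B N N') (hc : Commute N N')
    (k : ℕ) (v : V) (hv : (N ^ k) v = 0) : N v = 0 := by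
  induction k with
  | zero => simp at hv; simp [hv]
  | succ k ih =>
    cases k with
    | zero => simpa using hv
    | succ k =>
      apply ih
      rw [pow_succ', Module.End.mul_apply]
      apply normal_sq hB h hc
      rw [← Module.End.mul_apply, ← Module.End.mul_apply]
      rw [pow_succ', pow_succ', ← mul_assoc] at hv
      exact hv

end form

theorem mem_wt (A : SVAlgebra sv) (χ : ℂ × ℂ × ℂ) (v : V) :
    v ∈ svWeightSpace A V χ ↔ ⁅A.L 0, v⁆ = χ.1 • v ∧ ⁅A.M 0, v⁆ = χ.2.1 • v ∧
      ⁅A.c, v⁆ = χ.2.2 • v := by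
  simp [svWeightSpace, and_assoc]

/-- The operator of `x` on `V`. -/
abbrev op (x : sv) : Module.End ℂ V := LieModule.toEnd ℂ sv V x

theorem op_br (x y : sv) : (op x * op y - op y * op x : Module.End ℂ V) = op ⁅x, y⁆ := by
  ext v
  simp only [LinearMap.sub_apply, Module.End.mul_apply, LieModule.toEnd_apply_apply, lie_lie]

theorem op_commute (x y : sv) (h : ⁅x, y⁆ = 0) : Commute (op x : Module.End ℂ V) (op y) := by
  have := op_br (V := V) x y
  rw [h] at this
  simp only [op, map_zero] at this
  exact sub_eq_zero.mp this

theorem shift (A : SVAlgebra sv) (P : Module.End ℂ V) (a : ℂ)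
    (h0 : op (A.L 0) * P - P * op (A.L 0) = a • P) (h1 : Commute (op (A.M 0)) P)
    (h2 : Commute (op A.c) P) (χ : ℂ × ℂ × ℂ) (v : V) (hv : v ∈ svWeightSpace A V χ) :
    P v ∈ svWeightSpace A V (χ.1 + a, χ.2) := by
  rw [mem_wt] at hv ⊢
  obtain ⟨e0, e1, e2⟩ := hv
  have g0 := congrArg (fun f : Module.End ℂ V => f v) h0
  have g1 := congrArg (fun f : Module.End ℂ V => f v) h1.eq
  have g2 := congrArg (fun f : Module.End ℂ V => f v) h2.eq
  simp only [Module.End.mul_apply, LinearMap.sub_apply, LinearMap.smul_apply,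
    LieModule.toEnd_apply_apply, e0, e1, e2, map_smul] at g0 g1 g2
  refine ⟨?_, g1, g2⟩
  rw [sub_eq_iff_eq_add] at g0
  rw [g0, ← add_smul, add_comm]

theorem comm_of_double (A : SVAlgebra sv) (hwt : IsWeightModule A V) {B : V → V → ℂ}
    (hB : Form B) (X X' L : Module.End ℂ V) (h : Adj B X X') (hc : Commute X X')
    (h0 : Commute (op (A.L 0)) X) (h1 : Commute (op (A.M 0)) X) (h2 : Commute (op A.c) X)
    (hL : Commute X (X * L - L * X)) : X * L = L * X := by
  have eig : ∀ (μ : ℂ) (v : V), X v = μ • v → X (L v) = L (X v) := by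
    intro μ v hv
    have hadj := h.sub hB (Adj.scalar (V := V) hB μ)
    have hcc : Commute (X - algebraMap ℂ (Module.End ℂ V) μ)
        (X' - algebraMap ℂ (Module.End ℂ V) (starRingEnd ℂ μ)) :=
      Commute.sub_left (Commute.sub_right hc (Algebra.commutes _ _).symm)
        (Algebra.commutes _ _)
    have e := congrArg (fun f : Module.End ℂ V => f v) hL.eq
    simp only [Module.End.mul_apply, LinearMap.sub_apply, hv, map_smul, map_sub] at e
    have := normal_sq hB hadj hcc (L v) (by
      simp only [LinearMap.sub_apply, Module.algebraMap_end_apply, map_sub, map_smul]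
      rw [e]; simp [smul_sub])
    simp only [LinearMap.sub_apply, Module.algebraMap_end_apply] at this
    rw [hv, map_smul]
    exact sub_eq_zero.mp this
  have nrm : ∀ (μ : ℂ) (k : ℕ) (v : V),
      ((X - algebraMap ℂ (Module.End ℂ V) μ) ^ k) v = 0 → X v = μ • v := by
    intro μ k v hv
    have hadj := h.sub hB (Adj.scalar (V := V) hB μ)
    have hcc : Commute (X - algebraMap ℂ (Module.End ℂ V) μ)
        (X' - algebraMap ℂ (Module.End ℂ V) (starRingEnd ℂ μ)) :=
      Commute.sub_left (Commute.sub_right hc (Algebra.commutes _ _).symm)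
        (Algebra.commutes _ _)
    have := normal_pow hB hadj hcc k v hv
    simp only [LinearMap.sub_apply, Module.algebraMap_end_apply] at this
    exact sub_eq_zero.mp this
  ext v
  have hv : v ∈ ⨆ χ : ℂ × ℂ × ℂ, svWeightSpace A V χ := by rw [hwt.2]; trivial
  induction hv using Submodule.iSup_induction' with
  | zero => simp
  | add x y _ _ hx hy => rw [map_add, map_add, hx, hy]
  | mem χ v hv =>
    have hst : ∀ v ∈ svWeightSpace A V χ, X v ∈ svWeightSpace A V χ := by
      intro v hv
      have := shift A X 0 (by rw [h0.eq]; simp) h1 h2 χ v hv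
      simpa using this
    have := hwt.1 χ
    let R : Module.End ℂ (svWeightSpace A V χ) := X.restrict hst
    have hR : (⟨v, hv⟩ : svWeightSpace A V χ) ∈ ⨆ μ : ℂ, R.maxGenEigenspace μ := by
      rw [Module.End.iSup_maxGenEigenspace_eq_top]; trivial
    suffices hs : ∀ w ∈ ⨆ μ : ℂ, R.maxGenEigenspace μ, (X * L) (w : V) = (L * X) (w : V) from
      hs _ hR
    intro w hw
    induction hw using Submodule.iSup_induction' with
    | zero => simp
    | add x y _ _ hx hy => rw [Submodule.coe_add, map_add, map_add, hx, hy]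
    | mem μ w hw =>
      rw [Module.End.mem_maxGenEigenspace] at hw
      obtain ⟨k, hk⟩ := hw
      apply eig μ
      apply nrm μ k
      have : ∀ (k : ℕ) (w : svWeightSpace A V χ), (((R - μ • 1) ^ k) w : V) =
          ((X - algebraMap ℂ (Module.End ℂ V) μ) ^ k) w := by
        intro k
        induction k with
        | zero => simp
        | succ k ih =>
          intro w
          rw [pow_succ, pow_succ, Module.End.mul_apply, Module.End.mul_apply, ih]
          rfl
      rw [← this, hk]; rfl

theorem pair_lemma (A : SVAlgebra sv) (hwt : IsWeightModule A V) {B : V → V → ℂ}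
    (hB : Form B) (a b a' b' L : Module.End ℂ V) (ha : Adj B a a') (hb : Adj B b b')
    (c1 : Commute a a') (c2 : Commute a b') (c3 : Commute b a') (c4 : Commute b b')
    (h0 : Commute (op (A.L 0)) (a * b)) (h1 : Commute (op (A.M 0)) (a * b))
    (h2 : Commute (op A.c) (a * b))
    (hL : Commute (a * b) ((L * a - a * L) * b + a * (L * b - b * L))) :
    (L * a - a * L) * b + a * (L * b - b * L) = 0 := by
  have e : (L * a - a * L) * b + a * (L * b - b * L) = L * (a * b) - (a * b) * L := by
    noncomm_ring
  have := comm_of_double A hwt hB (a * b) (b' * a') L (ha.mul hb)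
    (Commute.mul_left (Commute.mul_right c2 c1) (Commute.mul_right c4 c3)) h0 h1 h2
    (by
      have : a * b * L - L * (a * b) = -((L * a - a * L) * b + a * (L * b - b * L)) := by
        rw [e]; abel
      rw [this]; exact hL.neg_right)
  rw [e, this, sub_self]

end SVProof
namespace SVProof

theorem op_add (x y : sv) : (op (x + y) : Module.End ℂ V) = op x + op y := map_add _ _ _
theorem op_smul (a : ℂ) (x : sv) : (op (a • x) : Module.End ℂ V) = a • op x := map_smul _ _ _

theorem cLM (A : SVAlgebra sv) (k n : ℤ) :
    (op (A.L k) * op (A.M n) - op (A.M n) * op (A.L k) : Module.End ℂ V)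
      = (n : ℂ) • op (A.M (k + n)) := by
  rw [op_br, A.bracket_LM]; simp [op]

theorem cLY (A : SVAlgebra sv) (k n : ℤ) :
    (op (A.L k) * op (A.Y n) - op (A.Y n) * op (A.L k) : Module.End ℂ V)
      = ((n : ℂ) + (1 - (k : ℂ)) / 2) • op (A.Y (k + n)) := by
  rw [op_br, A.bracket_LY]; simp [op]

theorem cMM (A : SVAlgebra sv) (m n : ℤ) :
    Commute (op (A.M m) : Module.End ℂ V) (op (A.M n)) := op_commute _ _ (A.bracket_MM m n)
theorem cMY (A : SVAlgebra sv) (m n : ℤ) :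
    Commute (op (A.M m) : Module.End ℂ V) (op (A.Y n)) := op_commute _ _ (A.bracket_MY m n)
theorem cc (A : SVAlgebra sv) (x : sv) :
    Commute (op A.c : Module.End ℂ V) (op x) := op_commute _ _ (br_c A x)

/-- Leibniz rule for commutators. -/
theorem leib {E : Type*} [Ring E] (L a b : E) :
    L * (a * b) - (a * b) * L = (L * a - a * L) * b + a * (L * b - b * L) := by
  noncomm_ring

section main
variable (A : SVAlgebra sv) (θ : ConjAntiInvolution sv)

theorem cMM' (m n : ℤ) :
    Commute (op (A.M m) : Module.End ℂ V) (op (θ.toFun (A.M n))) :=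
  (op_commute _ _ (theta_M_M A θ n m)).symm

theorem comm_transfer (n : ℤ)
    (ha : (op (A.M (2 * n)) * op (A.M (-n)) : Module.End ℂ V) = op (A.M n) * op (A.M 0))
    (hb : (op (A.M (-(2 * n))) * op (A.M n) : Module.End ℂ V) = op (A.M (-n)) * op (A.M 0))
    (hc : (op (A.M (2 * n)) * op (A.M (-(2 * n))) : Module.End ℂ V)
      = 2 * (op (A.M n) * op (A.M (-n))) - op (A.M 0) ^ 2) :
    (2 * (op (A.M n) * op (A.M (-n)) * (op (A.M n) * op (A.M (-n)) - op (A.M 0) ^ 2))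
      : Module.End ℂ V) = 0 := by
  let S : Set (Module.End ℂ V) := Set.range (fun n => op (A.M n))
  let _ : CommRing (Algebra.adjoin ℂ S) := Algebra.adjoinCommRingOfComm ℂ (by
    rintro _ ⟨a, rfl⟩ _ ⟨b, rfl⟩
    exact (cMM A a b).eq)
  let m : ℤ → Algebra.adjoin ℂ S := fun n => ⟨op (A.M n), Algebra.subset_adjoin ⟨n, rfl⟩⟩
  have ha' : m (2 * n) * m (-n) = m n * m 0 := Subtype.ext ha
  have hb' : m (-(2 * n)) * m n = m (-n) * m 0 := Subtype.ext hb
  have hc' : m (2 * n) * m (-(2 * n)) = 2 * (m n * m (-n)) - m 0 ^ 2 := Subtype.ext hc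
  have : 2 * (m n * m (-n) * (m n * m (-n) - m 0 ^ 2)) = 0 := by
    linear_combination (-(m n * m (-n))) * hc' + ha' * (m (-(2 * n)) * m n) + m n * m 0 * hb'
  exact congrArg Subtype.val this

theorem R1 (hwt : IsWeightModule A V)
    {B : V → V → ℂ} (hB : Form B) (hθ : ∀ (x : sv) (u v : V), B ⁅x, u⁆ v = B u ⁅θ.toFun x, v⁆)
    (n k : ℤ) (hn : n ≠ 0) :
    (op (A.M (k + n)) * op (A.M (-n)) : Module.End ℂ V) = op (A.M n) * op (A.M (k - n)) := by
  have hn' : (n : ℂ) ≠ 0 := by exact_mod_cast hn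
  have := pair_lemma A hwt hB (op (A.M n)) (op (A.M (-n))) (op (θ.toFun (A.M n)))
    (op (θ.toFun (A.M (-n)))) (op (A.L k)) (fun u v => hθ _ u v) (fun u v => hθ _ u v)
    (cMM' A θ _ _) (cMM' A θ _ _) (cMM' A θ _ _) (cMM' A θ _ _)
    (by
      apply sub_eq_zero.mp
      rw [leib, cLM, cLM]
      simp)
    (Commute.mul_right (cMM A _ _) (cMM A _ _))
    (Commute.mul_right (cc A _) (cc A _))
    (by
      rw [cLM, cLM]
      refine Commute.mul_left ?_ ?_ <;> refine Commute.add_right ?_ ?_ <;>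
      refine Commute.mul_right ?_ ?_ <;>
      first
        | exact cMM A _ _
        | exact (cMM A _ _).smul_right _)
  rw [cLM, cLM] at this
  push_cast at this
  rw [smul_mul_assoc, mul_smul_comm, neg_smul, ← sub_eq_add_neg, ← smul_sub] at this
  have h := (smul_eq_zero.mp this).resolve_left hn'
  rw [sub_eq_zero] at h
  rw [h, sub_eq_add_neg]

theorem Ra (hwt : IsWeightModule A V)
    {B : V → V → ℂ} (hB : Form B) (hθ : ∀ (x : sv) (u v : V), B ⁅x, u⁆ v = B u ⁅θ.toFun x, v⁆)
    (n : ℤ) (hn : n ≠ 0) :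
    (op (A.M (2 * n)) * op (A.M (-n)) : Module.End ℂ V) = op (A.M n) * op (A.M 0) := by
  have := R1 A θ hwt hB hθ n n hn
  rwa [sub_self, ← two_mul] at this

theorem R2 (hwt : IsWeightModule A V)
    {B : V → V → ℂ} (hB : Form B) (hθ : ∀ (x : sv) (u v : V), B ⁅x, u⁆ v = B u ⁅θ.toFun x, v⁆)
    (n : ℤ) (hn : n ≠ 0) :
    (op (A.M (2 * n)) * op (A.M (-(2 * n))) : Module.End ℂ V)
      = 2 * (op (A.M n) * op (A.M (-n))) - op (A.M 0) ^ 2 := by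
  have hn' : (n : ℂ) ≠ 0 := by exact_mod_cast hn
  have h1 := leib (op (A.L (-n)) : Module.End ℂ V) (op (A.M (2 * n))) (op (A.M (-n)))
  have h2 := leib (op (A.L (-n)) : Module.End ℂ V) (op (A.M n)) (op (A.M 0))
  rw [Ra A θ hwt hB hθ n hn, h2, cLM, cLM, cLM, cLM] at h1
  have e1 : -n + n = 0 := by ring
  have e2 : -n + 2 * n = n := by ring
  have e3 : -n + -n = -(2 * n) := by ring
  rw [e1, e2, e3] at h1
  push_cast at h1
  have h3 : (n : ℂ) • ((op (A.M (2 * n)) * op (A.M (-(2 * n))) : Module.End ℂ V)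
      - (2 * (op (A.M n) * op (A.M (-n))) - op (A.M 0) ^ 2)) = 0 := by
    simp only [smul_mul_assoc, mul_smul_comm, zero_smul, add_zero, mul_zero, mul_neg, mul_smul,
      neg_smul] at h1
    have e4 : (2 : Module.End ℂ V) * (op (A.M n) * op (A.M (-n)))
        = (2 : ℂ) • (op (A.M n) * op (A.M (-n))) := by rw [two_mul, two_smul]
    rw [smul_sub, smul_sub, pow_two, h1, e4, smul_comm (n : ℂ) (2 : ℂ)]
    abel
  exact sub_eq_zero.mp ((smul_eq_zero.mp h3).resolve_left hn')

theorem R3 (hwt : IsWeightModule A V)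
    {B : V → V → ℂ} (hB : Form B) (hθ : ∀ (x : sv) (u v : V), B ⁅x, u⁆ v = B u ⁅θ.toFun x, v⁆)
    (n : ℤ) (hn : n ≠ 0) :
    (op (A.M n) * op (A.M (-n)) * (op (A.M n) * op (A.M (-n)) - op (A.M 0) ^ 2)
      : Module.End ℂ V) = 0 := by
  have hb := Ra A θ hwt hB hθ (-n) (neg_ne_zero.mpr hn)
  rw [mul_neg, neg_neg] at hb
  have h := comm_transfer A n (Ra A θ hwt hB hθ n hn) hb (R2 A θ hwt hB hθ n hn)
  rw [two_mul, ← two_smul ℂ] at h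
  exact (smul_eq_zero.mp h).resolve_left two_ne_zero

theorem R4 (hwt : IsWeightModule A V)
    {B : V → V → ℂ} (hB : Form B) (hθ : ∀ (x : sv) (u v : V), B ⁅x, u⁆ v = B u ⁅θ.toFun x, v⁆)
    (n : ℤ) (hn : n ≠ 0) :
    (op (A.M n) * op (A.M (-n)) : Module.End ℂ V) = op (A.M 0) * op (A.M 0) := by
  have h1 := R3 A θ hwt hB hθ n hn
  have h2 := R3 A θ hwt hB hθ (2 * n) (by omega)
  rw [R2 A θ hwt hB hθ n hn] at h2
  set X : Module.End ℂ V := op (A.M n) * op (A.M (-n)) with hX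
  set Z : Module.End ℂ V := op (A.M 0) with hZ
  have h3 : (2 : ℂ) • ((X - Z ^ 2) * (X - Z ^ 2)) = 0 := by
    have e : (X - Z ^ 2) * (X - Z ^ 2) + (X - Z ^ 2) * (X - Z ^ 2)
      = (2 * X - Z ^ 2) * (2 * X - Z ^ 2 - Z ^ 2) - 2 * (X * (X - Z ^ 2)) := by
      noncomm_ring
    rw [two_smul, e, h1, h2]; simp
  have h4 := (smul_eq_zero.mp h3).resolve_left two_ne_zero
  have hadj : Adj B (X - Z ^ 2) (op (θ.toFun (A.M (-n))) * op (θ.toFun (A.M n))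
      - op (θ.toFun (A.M 0)) * op (θ.toFun (A.M 0))) := by
    rw [pow_two]
    exact Adj.sub hB (Adj.mul (fun u v => hθ (A.M n) u v) (fun u v => hθ (A.M (-n)) u v))
      (Adj.mul (fun u v => hθ (A.M 0) u v) (fun u v => hθ (A.M 0) u v))
  have : X - Z ^ 2 = 0 := by
    ext v
    apply normal_sq hB hadj
    · rw [pow_two]
      refine Commute.sub_left ?_ ?_ <;> refine Commute.sub_right ?_ ?_ <;>
      refine Commute.mul_left ?_ ?_ <;> refine Commute.mul_right ?_ ?_ <;>
      exact cMM' A θ _ _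
    · exact congrArg (fun f : Module.End ℂ V => f v) h4
  rw [← pow_two]
  exact sub_eq_zero.mp this

theorem M0_zero (hwt : IsWeightModule A V)
    {B : V → V → ℂ} (hB : Form B) (hθ : ∀ (x : sv) (u v : V), B ⁅x, u⁆ v = B u ⁅θ.toFun x, v⁆)
    : (op (A.M 0) : Module.End ℂ V) = 0 := by
  have hbot : ∀ χ : ℂ × ℂ × ℂ, χ.2.1 ≠ 0 → ∀ v ∈ svWeightSpace A V χ, v = 0 := by
    rintro ⟨l, F, e⟩ hF v hv
    simp only at hF
    have f1 := hwt.1 (l, F, e)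
    have f2 := hwt.1 (l + 1 / 2, F, e)
    have sC : ∀ (l : ℂ) (v : V), v ∈ svWeightSpace A V (l, F, e) →
        op (A.Y 0) v ∈ svWeightSpace A V (l + 1 / 2, F, e) := fun l v hv =>
      shift A (op (A.Y 0)) (1 / 2) (by rw [cLY]; simp) (cMY A _ _) (cc A _) (l, F, e) v hv
    have sD : ∀ (l : ℂ) (v : V), v ∈ svWeightSpace A V (l, F, e) →
        op (A.Y (-1)) v ∈ svWeightSpace A V (l - 1 / 2, F, e) := fun l v hv => by
      have := shift A (op (A.Y (-1))) (-1 / 2) (by rw [cLY]; norm_num) (cMY A _ _) (cc A _)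
        (l, F, e) v hv
      simpa [sub_eq_add_neg, neg_div] using this
    have sM : ∀ (n : ℤ) (l : ℂ) (v : V), v ∈ svWeightSpace A V (l, F, e) →
        op (A.M n) v ∈ svWeightSpace A V (l + n, F, e) := fun n l v hv =>
      shift A (op (A.M n)) n (by rw [cLM]; simp) (cMM A _ _) (cc A _) (l, F, e) v hv
    let p : svWeightSpace A V (l, F, e) →ₗ[ℂ] svWeightSpace A V (l + 1 / 2, F, e) :=
      (op (A.Y 0)).restrict (sC l)
    let q : svWeightSpace A V (l + 1 / 2, F, e) →ₗ[ℂ] svWeightSpace A V (l, F, e) :=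
      (op (A.Y (-1))).restrict (fun v hv => by
        have := sD _ v hv
        rwa [add_sub_cancel_right] at this)
    let p' : svWeightSpace A V (l + 1 / 2, F, e) →ₗ[ℂ] svWeightSpace A V (l, F, e) :=
      (op (A.M (-1)) * op (A.Y 0)).restrict (fun v hv => by
        have := sM (-1) _ _ (sC _ v hv)
        have e1 : l + 1 / 2 + 1 / 2 + ((-1 : ℤ) : ℂ) = l := by push_cast; ring
        rwa [e1] at this)
    let q' : svWeightSpace A V (l, F, e) →ₗ[ℂ] svWeightSpace A V (l + 1 / 2, F, e) :=
      (op (A.M 1) * op (A.Y (-1))).restrict (fun v hv => by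
        have := sM 1 _ _ (sD _ v hv)
        have e1 : l - 1 / 2 + ((1 : ℤ) : ℂ) = l + 1 / 2 := by push_cast; ring
        rwa [e1] at this)
    have hM0 : ∀ (l : ℂ) (v : V), v ∈ svWeightSpace A V (l, F, e) → ⁅A.M 0, v⁆ = F • v :=
      fun l v hv => ((mem_wt A _ v).mp hv).2.1
    have hMM : ∀ (l : ℂ) (v : V), v ∈ svWeightSpace A V (l, F, e) →
        ⁅A.M 1, ⁅A.M (-1), v⁆⁆ = (F * F) • v := by
      intro l v hv
      have := congrArg (fun f : Module.End ℂ V => f v) (R4 A θ hwt hB hθ 1 one_ne_zero)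
      simp only [Module.End.mul_apply, LieModule.toEnd_apply_apply, hM0 l v hv, lie_smul,
        smul_smul] at this
      exact this
    have hMMs : ∀ v : V, ⁅A.M (-1), ⁅A.M 1, v⁆⁆ = ⁅A.M 1, ⁅A.M (-1), v⁆⁆ := by
      intro v; rw [leibniz_lie, A.bracket_MM]; simp
    have hMY : ∀ (m n : ℤ) (v : V), ⁅A.Y n, ⁅A.M m, v⁆⁆ = ⁅A.M m, ⁅A.Y n, v⁆⁆ := by
      intro m n v; rw [leibniz_lie, br_YM]; simp
    have hCD : ∀ (l : ℂ) (v : V), v ∈ svWeightSpace A V (l, F, e) →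
        ⁅A.Y (-1), ⁅A.Y 0, v⁆⁆ - ⁅A.Y 0, ⁅A.Y (-1), v⁆⁆ = F • v := by
      intro l v hv
      rw [← lie_lie, A.bracket_YY, ← hM0 l v hv]; simp
    have t1 := LinearMap.trace_comp_comm' (R := ℂ) p q
    have t2 := LinearMap.trace_comp_comm' (R := ℂ) q' p'
    have k1 : (F * F) • (q ∘ₗ p) - p' ∘ₗ q' = (F * F * F) • LinearMap.id := by
      apply LinearMap.ext
      rintro ⟨v, hv⟩
      apply Subtype.ext
      change (F * F) • ⁅A.Y (-1), ⁅A.Y 0, v⁆⁆ - ⁅A.M (-1), ⁅A.Y 0, ⁅A.M 1, ⁅A.Y (-1), v⁆⁆⁆⁆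
        = (F * F * F) • v
      rw [hMY, hMMs, hMM _ ⁅A.Y 0, ⁅A.Y (-1), v⁆⁆ (sC _ _ (sD _ v hv)), mul_smul (F * F) F v, ← hCD l v hv, ← smul_sub]
    have k2 : (F * F) • (p ∘ₗ q) - q' ∘ₗ p' = -(F * F * F) • LinearMap.id := by
      apply LinearMap.ext
      rintro ⟨v, hv⟩
      apply Subtype.ext
      change (F * F) • ⁅A.Y 0, ⁅A.Y (-1), v⁆⁆ - ⁅A.M 1, ⁅A.Y (-1), ⁅A.M (-1), ⁅A.Y 0, v⁆⁆⁆⁆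
        = -(F * F * F) • v
      rw [hMY, hMM _ ⁅A.Y (-1), ⁅A.Y 0, v⁆⁆ (sD _ _ (sC _ v hv)), neg_smul, mul_smul (F * F) F v, ← hCD _ v hv, ← smul_sub,
        ← smul_neg, neg_sub]
    have g1 := congrArg (LinearMap.trace ℂ _) k1
    have g2 := congrArg (LinearMap.trace ℂ _) k2
    rw [map_sub, map_smul, map_smul, LinearMap.trace_id, t1, t2] at g1
    rw [map_sub, map_smul, map_smul, LinearMap.trace_id, g1] at g2
    simp only [smul_eq_mul] at g2
    have g3 : (F * F * F) * (((Module.finrank ℂ (svWeightSpace A V (l, F, e)) +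
        Module.finrank ℂ (svWeightSpace A V (l + 1 / 2, F, e)) : ℕ)) : ℂ) = 0 := by
      push_cast
      linear_combination g2
    have g4 := (mul_eq_zero.mp g3).resolve_left (by simp [hF])
    have g5 : Module.finrank ℂ (svWeightSpace A V (l, F, e)) = 0 := by
      have : _ = 0 := Nat.cast_eq_zero.mp g4
      omega
    have g6 := Submodule.finrank_eq_zero.mp g5
    rw [g6] at hv
    simpa using hv
  ext v
  have hv : v ∈ ⨆ χ : ℂ × ℂ × ℂ, svWeightSpace A V χ := by rw [hwt.2]; trivial
  induction hv using Submodule.iSup_induction' with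
  | zero => simp
  | add x y _ _ hx hy => rw [map_add, hx, hy]; simp
  | mem χ v hv =>
    by_cases h : χ.2.1 = 0
    · have := ((mem_wt A χ v).mp hv).2.1
      rw [h, zero_smul] at this
      exact this
    · rw [hbot χ h v hv]; simp

theorem M_zero (hwt : IsWeightModule A V)
    {B : V → V → ℂ} (hB : Form B) (hθ : ∀ (x : sv) (u v : V), B ⁅x, u⁆ v = B u ⁅θ.toFun x, v⁆)
    (n : ℤ) : (op (A.M n) : Module.End ℂ V) = 0 := by
  have h0 := M0_zero A θ hwt hB hθ
  by_cases hn : n = 0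
  · rw [hn, h0]
  have h1 := R4 A θ hwt hB hθ n hn
  rw [h0, mul_zero] at h1
  have h2 := R1 A θ hwt hB hθ n (2 * n) hn
  have e : 2 * n - n = n := by ring
  rw [e] at h2
  have h3 : (op (A.M n) : Module.End ℂ V) ^ 3 = 0 := by
    rw [pow_succ, pow_two, ← h2, mul_assoc, ((cMM A (-n) n).eq), h1, mul_zero]
  ext v
  exact normal_pow hB (N' := op (θ.toFun (A.M n))) (fun u v => hθ _ u v) (cMM' A θ _ _) 3 v
    (by rw [h3]; rfl)

theorem Y_zero (hwt : IsWeightModule A V)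
    {B : V → V → ℂ} (hB : Form B) (hθ : ∀ (x : sv) (u v : V), B ⁅x, u⁆ v = B u ⁅θ.toFun x, v⁆)
    (n : ℤ) : (op (A.Y n) : Module.End ℂ V) = 0 := by
  have hM := M_zero A θ hwt hB hθ
  have hYY : ∀ m n, Commute (op (A.Y m) : Module.End ℂ V) (op (A.Y n)) := by
    intro m n
    apply sub_eq_zero.mp
    rw [op_br, A.bracket_YY, op_smul, hM, smul_zero]
  have hspan : ∀ x ∈ Submodule.span ℂ (Set.range A.M), (op x : Module.End ℂ V) = 0 := by
    intro x hx
    induction hx using Submodule.span_induction with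
    | mem x hx => obtain ⟨n, rfl⟩ := hx; exact hM n
    | zero => simp [op]
    | add x y _ _ hx hy => rw [op_add, hx, hy, add_zero]
    | smul a x _ hx => rw [op_smul, hx, smul_zero]
  have hYY' : ∀ m n, Commute (op (A.Y m) : Module.End ℂ V) (op (θ.toFun (A.Y n))) := by
    intro m n
    apply Commute.symm
    apply sub_eq_zero.mp
    rw [op_br, hspan _ (theta_Y_Y A θ n m)]
  have := pair_lemma A hwt hB (op (A.Y n)) (op (A.Y (-1 - n))) (op (θ.toFun (A.Y n)))
    (op (θ.toFun (A.Y (-1 - n)))) (op (A.L (2 * n + 1))) (fun u v => hθ _ u v)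
    (fun u v => hθ _ u v)
    (hYY' _ _) (hYY' _ _) (hYY' _ _) (hYY' _ _)
    (by
      apply sub_eq_zero.mp
      rw [leib, cLY, cLY, smul_mul_assoc, mul_smul_comm, zero_add, zero_add, ← add_smul]
      push_cast
      ring_nf
      simp)
    (Commute.mul_right (cMY A _ _) (cMY A _ _))
    (Commute.mul_right (cc A _) (cc A _))
    (by
      rw [cLY, cLY]
      refine Commute.mul_left ?_ ?_ <;> refine Commute.add_right ?_ ?_ <;>
      refine Commute.mul_right ?_ ?_ <;>
      first
        | exact hYY _ _
        | exact (hYY _ _).smul_right _)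
  rw [cLY, cLY] at this
  have e1 : (n : ℂ) + (1 - ((2 * n + 1 : ℤ) : ℂ)) / 2 = 0 := by push_cast; ring
  have e2 : ((-1 - n : ℤ) : ℂ) + (1 - ((2 * n + 1 : ℤ) : ℂ)) / 2 = -((2 * n + 1 : ℤ) : ℂ) := by
    push_cast; ring
  have e3 : 2 * n + 1 + (-1 - n) = n := by ring
  have e4 : -((2 * n + 1 : ℤ) : ℂ) ≠ 0 := by
    rw [neg_ne_zero]
    exact_mod_cast (by omega : (2 * n + 1 : ℤ) ≠ 0)
  rw [e1, e2, e3, zero_smul, zero_mul, zero_add, mul_smul_comm] at this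
  have h := (smul_eq_zero.mp this).resolve_left e4
  ext v
  exact normal_sq hB (N' := op (θ.toFun (A.Y n))) (fun u v => hθ _ u v) (hYY' _ _) v
    (congrArg (fun f : Module.End ℂ V => f v) h)

end main
end SVProof
/-- A unitary weight module over `𝔰𝔳` is simply a unitary weight module over the
Virasoro subalgebra: `M` and `Y` act trivially. -/
theorem sv_unitary_weight_module_MY_trivial (A : SVAlgebra sv)
    (θ : ConjAntiInvolution sv)
    (hwt : IsWeightModule A V)
    (hunit : IsUnitaryFor (V := V) θ.toFun) :
    ∀ (n : ℤ) (v : V), ⁅A.M n, v⁆ = 0 ∧ ⁅A.Y n, v⁆ = 0 := by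
  obtain ⟨B, h1, h2, h3, h4, h5⟩ := hunit
  have hB : SVProof.Form B := ⟨h1, h2, h3, h4⟩
  intro n v
  exact ⟨congrArg (fun f : Module.End ℂ V => f v) (SVProof.M_zero A θ hwt hB h5 n),
    congrArg (fun f : Module.End ℂ V => f v) (SVProof.Y_zero A θ hwt hB h5 n)⟩
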